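/- arXiv:math/0702034 — 2 statements merged into one kernel-verified Lean document; each statement's English description precedes it below -/
import Mathlib

section
/- Let p ≥ 1 and let BS(p,p) be the Baumslag–Solitar group with presentation ⟨a, b | a⁻¹bᵖa = bᵖ⟩. Then the subgroup of BS(p,p) generated by the elements a and bᵖ is isomorphic to ℤ × ℤ (the free abelian group of rank 2). -/
/-- The single relator `a⁻¹ * bᵖ * a * b⁻ᑫ` defining the Baumslag–Solitar group
`BS(p,q) = ⟨a, b | a⁻¹bᵖa = bᑫ⟩`.  Here `true` plays the role of `a` and `false`
plays the role of `b`. -/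
def BSRels (p q : ℕ) : Set (FreeGroup Bool) :=
  {(FreeGroup.of true)⁻¹ * (FreeGroup.of false) ^ p * FreeGroup.of true *
    ((FreeGroup.of false) ^ q)⁻¹}

/-- The Baumslag–Solitar group `BS(p,q)`. -/
abbrev BaumslagSolitar (p q : ℕ) : Type := PresentedGroup (BSRels p q)

/-- The generator `a` of `BS(p,q)`. -/
def BSa (p q : ℕ) : BaumslagSolitar p q := PresentedGroup.of true

/-- The generator `b` of `BS(p,q)`. -/
def BSb (p q : ℕ) : BaumslagSolitar p q := PresentedGroup.of false

/-- Two commuting elements satisfying no nontrivial relation `x ^ m * y ^ n = 1` generate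
a free abelian group of rank 2. -/
theorem Commute.nonempty_closure_pair_mulEquiv {G : Type*} [Group G] {x y : G}
    (hxy : Commute x y) (h : ∀ m n : ℤ, x ^ m * y ^ n = 1 → m = 0 ∧ n = 0) :
    Nonempty ((Subgroup.closure {x, y} : Subgroup G) ≃* Multiplicative (ℤ × ℤ)) := by
  let f : Multiplicative ℤ × Multiplicative ℤ →* G :=
    (zpowersHom G x).noncommCoprod (zpowersHom G y) fun m n =>
      hxy.zpow_zpow m.toAdd n.toAdd
  have hf : Function.Injective f := by
    rw [injective_iff_map_eq_one]
    rintro ⟨m, n⟩ hmn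
    obtain ⟨hm, hn⟩ := h m.toAdd n.toAdd hmn
    exact Prod.ext hm hn
  have hrange : f.range = Subgroup.closure {x, y} := by
    refine (MonoidHom.noncommCoprod_range _ _ _).trans ?_
    rw [Set.insert_eq, Subgroup.closure_union,
      ← Subgroup.zpowers_eq_closure, ← Subgroup.zpowers_eq_closure]
    rfl
  exact ⟨((MonoidHom.ofInjective hf).trans (MulEquiv.subgroupCongr hrange)).symm.trans
    (MulEquiv.prodMultiplicative ℤ ℤ).symm⟩

theorem commute_BSa_BSb_pow (p : ℕ) : Commute (BSa p p) (BSb p p ^ p) := by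
  have h : (BSa p p)⁻¹ * BSb p p ^ p * BSa p p * (BSb p p ^ p)⁻¹ = 1 :=
    PresentedGroup.one_of_mem (rels := BSRels p p) (Set.mem_singleton _)
  rw [mul_inv_eq_one, mul_assoc, inv_mul_eq_iff_eq_mul] at h
  exact h.symm

/-- The homomorphism `BS(p,p) → ℤ × ℤ` sending `a` to `(1, 0)` and `b` to `(0, 1)`. -/
def BSExponents (p : ℕ) : BaumslagSolitar p p →* Multiplicative (ℤ × ℤ) :=
  PresentedGroup.toGroup
    (f := fun t => Multiplicative.ofAdd (if t then ((1, 0) : ℤ × ℤ) else (0, 1))) (by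
      rintro _ rfl
      simp [mul_comm])

theorem BSExponents_BSa (p : ℕ) : BSExponents p (BSa p p) = Multiplicative.ofAdd (1, 0) :=
  PresentedGroup.toGroup.of _

theorem BSExponents_BSb (p : ℕ) : BSExponents p (BSb p p) = Multiplicative.ofAdd (0, 1) :=
  PresentedGroup.toGroup.of _

/-- In `BS(p,p) = ⟨a, b | a⁻¹bᵖa = bᵖ⟩` with `p ≥ 1`, the subgroup generated by
`a` and `bᵖ` is isomorphic to `ℤ × ℤ`, the free abelian group of rank 2. -/
theorem bs_pp_subgroup_a_bp_iso_int_prod_int (p : ℕ) (hp : 1 ≤ p) :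
    Nonempty
      ((Subgroup.closure {BSa p p, (BSb p p) ^ p} : Subgroup (BaumslagSolitar p p))
        ≃* Multiplicative (ℤ × ℤ)) := by
  refine (commute_BSa_BSb_pow p).nonempty_closure_pair_mulEquiv fun m n h => ?_
  have h' := congrArg (fun g => (BSExponents p g).toAdd) h
  simp only [map_mul, map_zpow, map_pow, BSExponents_BSa, BSExponents_BSb, map_one, toAdd_mul,
    toAdd_zpow, toAdd_pow, toAdd_ofAdd, toAdd_one] at h'
  have hp' : p ≠ 0 := by omega
  simpa [Prod.ext_iff, hp'] using h'
end

section
/- Let p ≥ 2 and let G = ((ℤ/pℤ) ∗ ℤ) × ℤ, where ∗ denotes the free product of groups. Let h ∈ G be the image of a generator of the factor ℤ/pℤ (paired with 0 in the second coordinate), let f ∈ G be the image of a generator of the free factor ℤ (paired with 0), and let t = (1, 1) ∈ G with second coordinate a generator of the direct factor ℤ. Then the homomorphism from BS(p,p) = ⟨a, b | a⁻¹bᵖa = bᵖ⟩ to G determined by a ↦ f and b ↦ h·t is well defined and injective; in particular, G contains a nonabelian subgroup isomorphic to BS(p,p). -/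
/-- The group `G = ((ℤ/pℤ) ∗ ℤ) × ℤ`, the direct product of the free product of a
cyclic group of order `p` and an infinite cyclic group with an infinite cyclic
group (all written multiplicatively). -/
abbrev GroupG (p : ℕ) : Type :=
  (Monoid.Coprod (Multiplicative (ZMod p)) (Multiplicative ℤ)) × Multiplicative ℤ

/-- `h`: a generator of the `ℤ/pℤ` free-product factor, paired with `0` in the
second coordinate. -/
def elemH (p : ℕ) : GroupG p :=
  (Monoid.Coprod.inl (Multiplicative.ofAdd (1 : ZMod p)), 1)

/-- `f`: a generator of the free factor `ℤ`, paired with `0` in the second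
coordinate. -/
def elemF (p : ℕ) : GroupG p :=
  (Monoid.Coprod.inr (Multiplicative.ofAdd (1 : ℤ)), 1)

/-- `t = (1, 1)`: the identity in the free-product coordinate paired with a
generator of the direct factor `ℤ`. -/
def elemT (p : ℕ) : GroupG p :=
  (1, Multiplicative.ofAdd (1 : ℤ))

/-- The element `bᵖ` is central in `BS(p,p)`. -/
theorem BSb_pow_mem_center (p : ℕ) : BSb p p ^ p ∈ Subgroup.center (BaumslagSolitar p p) := by
  have hrel : (BSa p p)⁻¹ * BSb p p ^ p * BSa p p * (BSb p p ^ p)⁻¹ = 1 :=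
    PresentedGroup.one_of_mem (rels := BSRels p p) rfl
  have ha : Commute (BSa p p) (BSb p p ^ p) := by
    have h := mul_inv_eq_one.mp hrel
    rw [mul_assoc, inv_mul_eq_iff_eq_mul] at h
    exact h.symm
  have hgen : Subgroup.centralizer {BSb p p ^ p} = ⊤ := by
    rw [eq_top_iff, ← PresentedGroup.closure_range_of (BSRels p p), Subgroup.closure_le]
    rintro _ ⟨_ | _, rfl⟩
    · exact Subgroup.mem_centralizer_singleton_iff.mpr (Commute.self_pow (BSb p p) p)
    · exact Subgroup.mem_centralizer_singleton_iff.mpr ha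
  rw [Subgroup.mem_center_iff]
  intro g
  exact Subgroup.mem_centralizer_singleton_iff.mp (hgen ▸ Subgroup.mem_top g)

/-- The homomorphism from the cyclic group of order `p` sending the generator to an element `x`
with `x ^ p = 1`. -/
def zmodPowersHom {Q : Type*} [Group Q] (p : ℕ) (x : Q) (hx : x ^ p = 1) :
    Multiplicative (ZMod p) →* Q :=
  AddMonoidHom.toMultiplicativeLeft
    (ZMod.lift p ⟨zmultiplesHom (Additive Q) (Additive.ofMul x), by
      rw [zmultiplesHom_apply, natCast_zsmul, ← ofMul_pow, hx, ofMul_one]⟩)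

theorem zmodPowersHom_ofAdd_one {Q : Type*} [Group Q] (p : ℕ) (x : Q) (hx : x ^ p = 1) :
    zmodPowersHom p x hx (Multiplicative.ofAdd 1) = x := by
  have h := ZMod.lift_coe p ⟨zmultiplesHom (Additive Q) (Additive.ofMul x), by
      rw [zmultiplesHom_apply, natCast_zsmul, ← ofMul_pow, hx, ofMul_one]⟩ 1
  rw [Int.cast_one] at h
  exact h.trans (one_zsmul (Additive.ofMul x))

theorem elemH_mul_elemT_pow (p : ℕ) :
    (elemH p * elemT p) ^ p = (1, Multiplicative.ofAdd (p : ℤ)) := by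
  have hz : (Multiplicative.ofAdd (1 : ZMod p)) ^ p = 1 := by
    rw [← ofAdd_nsmul, nsmul_one, ZMod.natCast_self, ofAdd_zero]
  have ht : (Multiplicative.ofAdd (1 : ℤ)) ^ p = Multiplicative.ofAdd (p : ℤ) := by
    rw [← ofAdd_nsmul, nsmul_one]
  simp [elemH, elemT, ← map_pow, hz, ht]

/-- The homomorphism `BS(p,p) → ((ℤ/pℤ) ∗ ℤ) × ℤ` with `a ↦ f` and `b ↦ h·t`. -/
def bsToGroupG (p : ℕ) : BaumslagSolitar p p →* GroupG p :=
  PresentedGroup.toGroup (f := fun i => cond i (elemF p) (elemH p * elemT p)) (by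
    rintro _ rfl
    simp [elemH_mul_elemT_pow, elemF])

theorem bsToGroupG_BSa (p : ℕ) : bsToGroupG p (BSa p p) = elemF p :=
  PresentedGroup.toGroup.of _

theorem bsToGroupG_BSb (p : ℕ) : bsToGroupG p (BSb p p) = elemH p * elemT p :=
  PresentedGroup.toGroup.of _

/-- An element of `BS(p,p)` that dies in `(ℤ/pℤ) ∗ ℤ` is a power of `bᵖ`, because
`(ℤ/pℤ) ∗ ℤ` maps back to the quotient of `BS(p,p)` by the central subgroup `⟨bᵖ⟩`. -/
theorem mem_zpowers_of_bsToGroupG_fst_eq_one (p : ℕ) {x : BaumslagSolitar p p}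
    (hx : (bsToGroupG p x).1 = 1) : x ∈ Subgroup.zpowers (BSb p p ^ p) := by
  have : (Subgroup.zpowers (BSb p p ^ p)).Normal :=
    ⟨fun z hz g => by
      have hc := (Subgroup.zpowers_le.mpr (BSb_pow_mem_center p)) hz
      rwa [Subgroup.mem_center_iff.mp hc g, mul_inv_cancel_right]⟩
  let π := QuotientGroup.mk' (Subgroup.zpowers (BSb p p ^ p))
  have hb : π (BSb p p) ^ p = 1 := by
    rw [← map_pow]
    exact (QuotientGroup.eq_one_iff _).mpr (Subgroup.mem_zpowers _)
  let ψ := Monoid.Coprod.lift (zmodPowersHom p (π (BSb p p)) hb) (zpowersHom _ (π (BSa p p)))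
  have hψ : (ψ.comp (MonoidHom.fst _ _)).comp (bsToGroupG p) = π := by
    refine PresentedGroup.ext fun i => ?_
    cases i
    · change ψ (bsToGroupG p (BSb p p)).1 = π (BSb p p)
      simp [ψ, bsToGroupG_BSb, elemH, elemT, zmodPowersHom_ofAdd_one]
    · change ψ (bsToGroupG p (BSa p p)).1 = π (BSa p p)
      simp [ψ, bsToGroupG_BSa, elemF]
  refine (QuotientGroup.eq_one_iff x).mp ?_
  change π x = 1
  rw [← hψ]
  change ψ (bsToGroupG p x).1 = 1
  rw [hx, map_one]

theorem bsToGroupG_injective (p : ℕ) (hp : p ≠ 0) : Function.Injective (bsToGroupG p) := by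
  rw [injective_iff_map_eq_one]
  intro x hx
  obtain ⟨n, rfl⟩ :=
    Subgroup.mem_zpowers_iff.mp (mem_zpowers_of_bsToGroupG_fst_eq_one p (congrArg Prod.fst hx))
  rw [map_zpow, map_pow, bsToGroupG_BSb, elemH_mul_elemT_pow] at hx
  have hn : n * (p : ℤ) = 0 := by
    have h := congrArg (fun y => Multiplicative.toAdd (Prod.snd y)) hx
    simpa using h
  have hn0 : n = 0 := (mul_eq_zero.mp hn).resolve_right (Nat.cast_ne_zero.mpr hp)
  rw [hn0, zpow_zero]

/-- For `p ≥ 2`, the assignment `a ↦ f`, `b ↦ h·t` determines a well-defined and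
injective homomorphism `BS(p,p) → ((ℤ/pℤ) ∗ ℤ) × ℤ`; in particular this group
contains a nonabelian subgroup isomorphic to `BS(p,p)`. -/
theorem bs_pp_embeds_in_coprod_prod_int (p : ℕ) (hp : 2 ≤ p) :
    ∃ φ : BaumslagSolitar p p →* GroupG p,
      φ (BSa p p) = elemF p ∧ φ (BSb p p) = elemH p * elemT p ∧
        Function.Injective φ := by
  exact ⟨bsToGroupG p, bsToGroupG_BSa p, bsToGroupG_BSb p,
    bsToGroupG_injective p (by omega)⟩
end
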